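/- arXiv:0912.1411 — 2 statements merged into one kernel-verified Lean document; each statement's English description precedes it below -/
import Mathlib

section
/- For n ≥ 3, every n×n dissimilarity matrix M (a symmetric real matrix with entries indexed by 2-element subsets of [n]) can be written as the entrywise minimum of at most n−2 star tree matrices, where a star tree matrix is one of the form M_{ij} = v_i + v_j for some v ∈ ℝ^n (restricted to off-diagonal entries). -/
/-- Off-diagonal entrywise (tropical) minimum decomposition of a dissimilarity matrix. -/
def DissMinDecomp {n r : ℕ} (M : Fin n → Fin n → ℝ) (N : Fin r → Fin n → Fin n → ℝ) : Prop :=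
  ∀ i j : Fin n, i ≠ j → (∀ k, M i j ≤ N k i j) ∧ (∃ k, M i j = N k i j)

/-- The dissimilarity matrix `M` has star tree rank at most `r`: it is the
entrywise minimum of `r` star tree matrices `(v k i + v k j)`. -/
def StarRankLe {n : ℕ} (r : ℕ) (M : Fin n → Fin n → ℝ) : Prop :=
  ∃ v : Fin r → Fin n → ℝ, DissMinDecomp M (fun k i j => v k i + v k j)

theorem stmt7_aux (m : ℕ) : ∀ (M : Fin (m + 3) → Fin (m + 3) → ℝ)
    (_ : ∀ i j, M i j = M j i), StarRankLe (m + 1) M := by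
  induction m with
  | zero =>
    intro M hs
    refine ⟨fun _ => ![(M 0 1 + M 0 2 - M 1 2) / 2, (M 0 1 + M 1 2 - M 0 2) / 2,
      (M 0 2 + M 1 2 - M 0 1) / 2], ?_⟩
    have h1 := hs 1 0
    have h2 := hs 2 0
    have h3 := hs 2 1
    have key : ∀ i j : Fin 3, i ≠ j → M i j =
        (![(M 0 1 + M 0 2 - M 1 2) / 2, (M 0 1 + M 1 2 - M 0 2) / 2,
          (M 0 2 + M 1 2 - M 0 1) / 2] : Fin 3 → ℝ) i +
        (![(M 0 1 + M 0 2 - M 1 2) / 2, (M 0 1 + M 1 2 - M 0 2) / 2,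
          (M 0 2 + M 1 2 - M 0 1) / 2] : Fin 3 → ℝ) j := by
      intro i j hij
      fin_cases i <;> fin_cases j <;> simp at hij ⊢ <;> linarith
    intro i j hij
    exact ⟨fun _ => (key i j hij).le, 0, key i j hij⟩
  | succ m ih =>
    intro M hs
    obtain ⟨v, hv⟩ := ih (fun i j => M i.succ j.succ) (fun i j => hs _ _)
    obtain ⟨K, hK⟩ := (Set.finite_range
      (fun p : Fin (m + 3) × Fin (m + 3) =>
        M p.1.succ p.2.succ - M 0 p.1.succ - M 0 p.2.succ)).bddAbove
    obtain ⟨B, hB⟩ := (Set.finite_range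
      (fun p : Fin (m + 1) × Fin (m + 3) => M 0 p.2.succ - v p.1 p.2)).bddAbove
    have hK' : ∀ i j : Fin (m + 3), M i.succ j.succ - M 0 i.succ - M 0 j.succ ≤ K :=
      fun i j => hK ⟨(i, j), rfl⟩
    have hB' : ∀ k j, M 0 (Fin.succ j) - v k j ≤ B := fun k j => hB ⟨(k, j), rfl⟩
    let w : Fin (m + 1 + 1) → Fin (m + 1 + 3) → ℝ :=
      Fin.cons (Fin.cons (-K / 2) (fun j => M 0 j.succ + K / 2))
        (fun k => Fin.cons B (v k))
    have w00 : w 0 0 = -K / 2 := rfl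
    have w0s : ∀ j : Fin (m + 3), w 0 j.succ = M 0 j.succ + K / 2 := fun _ => rfl
    have ws0 : ∀ k : Fin (m + 1), w k.succ 0 = B := fun _ => rfl
    have wss : ∀ (k : Fin (m + 1)) (j : Fin (m + 3)), w k.succ j.succ = v k j :=
      fun _ _ => rfl
    have h0 : ∀ j : Fin (m + 3), (∀ k, M 0 j.succ ≤ w k 0 + w k j.succ) ∧
        ∃ k, M 0 j.succ = w k 0 + w k j.succ := by
      intro j
      refine ⟨fun k => ?_, 0, ?_⟩
      · refine Fin.cases ?_ (fun k => ?_) k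
        · rw [w00, w0s]; linarith
        · rw [ws0, wss]; linarith [hB' k j]
      · rw [w00, w0s]; ring
    refine ⟨w, fun i j => ?_⟩
    refine Fin.cases ?_ (fun i => ?_) i <;> refine Fin.cases ?_ (fun j => ?_) j
    · intro h; exact absurd rfl h
    · intro _; exact h0 j
    · intro _
      obtain ⟨h1, k, h2⟩ := h0 i
      refine ⟨fun k => ?_, k, ?_⟩
      · have := h1 k
        rw [hs]; dsimp only; linarith
      · rw [hs]; dsimp only; linarith
    · intro hij
      obtain ⟨h1, k, h2⟩ := hv i j (fun h => hij (by rw [h]))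
      refine ⟨fun k => ?_, k.succ, ?_⟩
      · refine Fin.cases ?_ (fun k => ?_) k
        · dsimp only; rw [w0s, w0s]; linarith [hK' i j]
        · dsimp only; rw [wss, wss]; exact h1 k
      · dsimp only; rw [wss, wss]; exact h2

theorem stmt7 (n : ℕ) (hn : 3 ≤ n) (M : Fin n → Fin n → ℝ)
    (hsym : ∀ i j, M i j = M j i) :
    StarRankLe (n - 2) M := by
  obtain ⟨m, rfl⟩ : ∃ m, n = m + 3 := ⟨n - 3, by omega⟩
  exact stmt7_aux m M hsym
end

section
/- Every 6×6 dissimilarity matrix can be written as the entrywise minimum of at most 3 tree matrices; consequently, for all n ≥ 6, every n×n dissimilarity matrix has tree rank at most n−3. -/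
/-- A tree matrix: a symmetric dissimilarity matrix satisfying the four-point
condition (the minimum of the three Plücker pairwise sums is attained at least
twice for every quadruple of distinct indices). -/
def TreeMatrix {n : ℕ} (D : Fin n → Fin n → ℝ) : Prop :=
  (∀ i j, D i j = D j i) ∧
  ∀ i j k l : Fin n, i ≠ j → i ≠ k → i ≠ l → j ≠ k → j ≠ l → k ≠ l →
    (D i j + D k l = D i k + D j l ∧ D i j + D k l ≤ D i l + D j k) ∨
    (D i j + D k l = D i l + D j k ∧ D i j + D k l ≤ D i k + D j l) ∨
    (D i k + D j l = D i l + D j k ∧ D i k + D j l ≤ D i j + D k l)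

/-- The dissimilarity matrix `M` has tree rank at most `r`. -/
def TreeRankLe {n : ℕ} (r : ℕ) (M : Fin n → Fin n → ℝ) : Prop :=
  ∃ T : Fin r → Fin n → Fin n → ℝ, (∀ k, TreeMatrix (T k)) ∧ DissMinDecomp M (fun k => T k)


/-- The pair `i j` is a heaviest edge across some cut, for the weights `M x y - a x - a y`. -/
def Cov {n : ℕ} (M : Fin n → Fin n → ℝ) (a : Fin n → ℝ) (i j : Fin n) : Prop :=
  ∃ S : Finset (Fin n), i ∈ S ∧ j ∉ S ∧
    ∀ x ∈ S, ∀ y, y ∉ S → M x y - a x - a y ≤ M i j - a i - a j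

def VR {n : ℕ} (r : ℕ) (M : Fin n → Fin n → ℝ) : Prop :=
  ∃ a : Fin r → Fin n → ℝ, ∀ i j, i ≠ j → ∃ k, Cov M (a k) i j

lemma Cov.symm {n : ℕ} {M : Fin n → Fin n → ℝ} (hM : ∀ i j, M i j = M j i) {a : Fin n → ℝ}
    {i j : Fin n} (h : Cov M a i j) : Cov M a j i := by
  obtain ⟨S, hi, hj, h⟩ := h
  refine ⟨Sᶜ, by simpa using hj, by simpa using hi, fun x hx y hy => ?_⟩
  have := h y (by simpa using hy) x (by simpa using hx)
  rw [hM x y, hM j i]; linarith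

lemma VR_of_lt {n r : ℕ} {M : Fin n → Fin n → ℝ} (hM : ∀ i j, M i j = M j i)
    (a : Fin r → Fin n → ℝ) (h : ∀ i j, i < j → ∃ k, Cov M (a k) i j) : VR r M := by
  refine ⟨a, fun i j hij => ?_⟩
  rcases lt_or_gt_of_ne hij with h1 | h1
  · exact h i j h1
  · obtain ⟨k, hk⟩ := h j i h1
    exact ⟨k, hk.symm hM⟩

lemma exists_ub {ι : Type*} [Finite ι] (f : ι → ℝ) : ∃ L, ∀ i, f i ≤ L := by
  obtain ⟨L, hL⟩ := (Set.finite_range f).bddAbove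
  exact ⟨L, fun i => hL ⟨i, rfl⟩⟩

/-- admissible cut values -/
def cutSet {n : ℕ} (W : Fin n → Fin n → ℝ) (i j : Fin n) : Set ℝ :=
  {t | ∃ S : Finset (Fin n), i ∈ S ∧ j ∉ S ∧ ∀ x ∈ S, ∀ y, y ∉ S → W x y ≤ t}

lemma four_of_ultra (p q r s t u : ℝ)
    (h1 : (p = q ∧ p ≤ s) ∨ (p = s ∧ p ≤ q) ∨ (q = s ∧ q ≤ p))
    (h2 : (p = r ∧ p ≤ t) ∨ (p = t ∧ p ≤ r) ∨ (r = t ∧ r ≤ p))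
    (h3 : (q = r ∧ q ≤ u) ∨ (q = u ∧ q ≤ r) ∨ (r = u ∧ r ≤ q))
    (h4 : (s = t ∧ s ≤ u) ∨ (s = u ∧ s ≤ t) ∨ (t = u ∧ t ≤ s)) :
    (p + u = q + t ∧ p + u ≤ r + s) ∨ (p + u = r + s ∧ p + u ≤ q + t) ∨
    (q + t = r + s ∧ q + t ≤ p + u) := by
  rcases h1 with ⟨h1, h1'⟩ | ⟨h1, h1'⟩ | ⟨h1, h1'⟩ <;>
  rcases h2 with ⟨h2, h2'⟩ | ⟨h2, h2'⟩ | ⟨h2, h2'⟩ <;>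
  rcases h3 with ⟨h3, h3'⟩ | ⟨h3, h3'⟩ | ⟨h3, h3'⟩ <;>
  rcases h4 with ⟨h4, h4'⟩ | ⟨h4, h4'⟩ | ⟨h4, h4'⟩ <;>
  first
    | (left; constructor <;> linarith)
    | (right; left; constructor <;> linarith)
    | (right; right; constructor <;> linarith)

lemma tree_of {n : ℕ} {M : Fin n → Fin n → ℝ} (hM : ∀ i j, M i j = M j i) (a : Fin n → ℝ) :
    ∃ N, TreeMatrix N ∧ (∀ i j, i ≠ j → M i j ≤ N i j) ∧
      ∀ i j, i ≠ j → Cov M a i j → M i j = N i j := by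
  set W : Fin n → Fin n → ℝ := fun x y => M x y - a x - a y with hW
  set U : Fin n → Fin n → ℝ := fun x y => sInf (cutSet W x y) with hU
  have hWs : ∀ x y, W x y = W y x := fun x y => by simp only [hW]; rw [hM x y]; ring
  have hcs : ∀ x y, cutSet W x y = cutSet W y x := by
    have : ∀ x y, cutSet W x y ⊆ cutSet W y x := by
      rintro x y t ⟨S, h1, h2, h3⟩
      refine ⟨Sᶜ, by simpa using h2, by simpa using h1, fun u hu v hv => ?_⟩
      rw [hWs]; exact h3 v (by simpa using hv) u (by simpa using hu)
    exact fun x y => Set.Subset.antisymm (this x y) (this y x)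
  have hUs : ∀ x y, U x y = U y x := fun x y => by simp only [hU]; rw [hcs]
  have hlow : ∀ x y, ∀ t ∈ cutSet W x y, W x y ≤ t := by
    rintro x y t ⟨S, h1, h2, h3⟩
    exact h3 x h1 y h2
  have hbdd : ∀ x y, BddBelow (cutSet W x y) := fun x y => ⟨W x y, hlow x y⟩
  obtain ⟨L, hL⟩ := exists_ub (fun p : Fin n × Fin n => W p.1 p.2)
  have hne : ∀ x y, x ≠ y → (cutSet W x y).Nonempty := fun x y hxy =>
    ⟨L, {x}, by simp, by simpa using hxy.symm, fun u _ v _ => hL (u, v)⟩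
  have hWU : ∀ x y, x ≠ y → W x y ≤ U x y := fun x y hxy =>
    le_csInf (hne x y hxy) (hlow x y)
  have hult : ∀ x y z, x ≠ z → min (U x y) (U y z) ≤ U x z := by
    intro x y z hxz
    refine le_csInf (hne x z hxz) ?_
    rintro t ⟨S, h1, h2, h3⟩
    by_cases hy : y ∈ S
    · exact (min_le_right _ _).trans (csInf_le (hbdd _ _) ⟨S, hy, h2, h3⟩)
    · exact (min_le_left _ _).trans (csInf_le (hbdd _ _) ⟨S, h1, hy, h3⟩)
  have htri : ∀ x y z, x ≠ y → x ≠ z → y ≠ z →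
      (U x y = U x z ∧ U x y ≤ U y z) ∨ (U x y = U y z ∧ U x y ≤ U x z) ∨
      (U x z = U y z ∧ U x z ≤ U x y) := by
    intro x y z hxy hxz hyz
    have e1 := hult x y z hxz
    have e2 := hult x z y hxy
    have e3 := hult y x z hyz
    rw [hUs z y] at e2
    rw [hUs y x] at e3
    rw [min_le_iff] at e1 e2 e3
    grind
  refine ⟨fun x y => a x + a y + U x y, ⟨fun i j => ?_, ?_⟩, ?_, ?_⟩
  · show a i + a j + U i j = a j + a i + U j i
    rw [hUs i j]; ring
  · intro i j k l hij hik hil hjk hjl hkl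
    have := four_of_ultra (U i j) (U i k) (U i l) (U j k) (U j l) (U k l)
      (htri i j k hij hik hjk) (htri i j l hij hil hjl) (htri i k l hik hil hkl)
      (htri j k l hjk hjl hkl)
    rcases this with h | h | h
    · left; constructor <;> linarith [h.1, h.2]
    · right; left; constructor <;> linarith [h.1, h.2]
    · right; right; constructor <;> linarith [h.1, h.2]
  · intro i j hij
    have := hWU i j hij
    simp only [hW] at this
    linarith
  · intro i j hij hc
    have h1 := hWU i j hij
    have h2 : U i j ≤ W i j := csInf_le (hbdd _ _) hc
    have h3 : U i j = W i j := le_antisymm h2 h1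
    simp only [hW] at h3
    linarith

lemma treeRank_of_VR {n r : ℕ} {M : Fin n → Fin n → ℝ} (hM : ∀ i j, M i j = M j i)
    (h : VR r M) : TreeRankLe r M := by
  obtain ⟨a, ha⟩ := h
  choose N hN using fun k => tree_of hM (a k)
  refine ⟨N, fun k => (hN k).1, fun i j hij => ⟨fun k => (hN k).2.1 i j hij, ?_⟩⟩
  obtain ⟨k, hk⟩ := ha i j hij
  exact ⟨k, (hN k).2.2 i j hij hk⟩

lemma star {n : ℕ} {M : Fin n → Fin n → ℝ} (hM : ∀ i j, M i j = M j i) (i : Fin n) :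
    ∃ a : Fin n → ℝ, (∀ x, x ≠ i → Cov M a i x) ∧
      ∀ x y, x ≠ i → y ≠ i → ∀ S : Finset (Fin n), x ∈ S → y ∉ S →
        (∀ u ∈ S, ∀ v, v ∉ S → u ≠ i → v ≠ i →
          M u v - M i u - M i v ≤ M x y - M i x - M i y) → Cov M a x y := by
  obtain ⟨L, hL⟩ := exists_ub (fun p : Fin n × Fin n => M i p.1 + M i p.2 - M p.1 p.2)
  refine ⟨fun x => if x = i then 0 else M i x - L, ?_, ?_⟩
  · intro x hx
    refine ⟨{i}, by simp, by simpa using hx, ?_⟩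
    intro u hu v hv
    simp only [Finset.mem_singleton] at hu hv
    subst hu
    simp [hx, hv]
  · intro x y hx hy S hxS hyS h
    refine ⟨S, hxS, hyS, ?_⟩
    intro u hu v hv
    have hb := hL (x, y)
    simp only at hb
    have huv : u ≠ v := fun h => hv (h ▸ hu)
    by_cases h1 : u = i
    · subst h1
      simp only [if_neg hx, if_neg hy, if_neg huv.symm, if_true]
      linarith
    · by_cases h2 : v = i
      · subst h2
        simp only [if_neg hx, if_neg hy, if_neg huv, if_true]
        rw [hM u v]
        linarith
      · have := h u hu v hv h1 h2
        simp only [if_neg hx, if_neg hy, if_neg h1, if_neg h2]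
        linarith

lemma ext_cov {n : ℕ} (M : Fin (n + 1) → Fin (n + 1) → ℝ)
    (a : Fin n → ℝ) : ∃ a' : Fin (n + 1) → ℝ, ∀ i j : Fin n,
      Cov (fun i j => M i.castSucc j.castSucc) a i j → Cov M a' i.castSucc j.castSucc := by
  obtain ⟨K, hK⟩ := exists_ub (fun p : Fin n × Fin n × Fin n =>
    M p.1.castSucc (Fin.last n) - a p.1 - (M p.2.1.castSucc p.2.2.castSucc - a p.2.1 - a p.2.2))
  refine ⟨Fin.snoc a K, ?_⟩
  rintro i j ⟨S, hi, hj, h⟩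
  refine ⟨S.map Fin.castSuccEmb, by simpa using hi, by simpa using hj, ?_⟩
  intro x hx y hy
  simp only [Finset.mem_map, Fin.coe_castSuccEmb] at hx
  obtain ⟨x, hx, rfl⟩ := hx
  refine Fin.lastCases ?_ (fun y hy => ?_) y hy
  · intro _
    have := hK (x, i, j)
    simp only [Fin.snoc_castSucc, Fin.snoc_last] at *
    linarith
  · have := h x hx y (by simpa using hy)
    simpa only [Fin.snoc_castSucc] using this

lemma VR_succ {n r : ℕ} {M : Fin (n + 1) → Fin (n + 1) → ℝ} (hM : ∀ i j, M i j = M j i)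
    (h : VR r (fun i j : Fin n => M i.castSucc j.castSucc)) : VR (r + 1) M := by
  obtain ⟨a, ha⟩ := h
  choose b hb using fun k => ext_cov M (a k)
  obtain ⟨s, hs, -⟩ := star hM (Fin.last n)
  refine ⟨Fin.snoc b s, fun i j => ?_⟩
  refine Fin.lastCases ?_ (fun i => ?_) i
  · intro hj
    exact ⟨Fin.last r, by simpa using hs j hj.symm⟩
  · refine Fin.lastCases ?_ (fun j => ?_) j
    · intro hi
      exact ⟨Fin.last r, by simpa using (hs _ hi).symm hM⟩
    · intro hij
      obtain ⟨k, hk⟩ := ha i j (fun e => hij (by rw [e]))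
      exact ⟨k.castSucc, by simpa using hb k i j hk⟩

lemma Cov_perm {n : ℕ} {M : Fin n → Fin n → ℝ} (σ : Equiv.Perm (Fin n)) {a : Fin n → ℝ}
    {i j : Fin n} (h : Cov (fun i j => M (σ i) (σ j)) a i j) :
    Cov M (fun x => a (σ.symm x)) (σ i) (σ j) := by
  obtain ⟨S, hi, hj, h⟩ := h
  refine ⟨S.map σ.toEmbedding, by simpa using hi, by simpa using hj, ?_⟩
  intro x hx y hy
  have := h (σ.symm x) (by simpa [Finset.mem_map_equiv] using hx) (σ.symm y)
    (by simpa [Finset.mem_map_equiv] using hy)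
  simpa using this

lemma VR_perm {n r : ℕ} {M : Fin n → Fin n → ℝ} (σ : Equiv.Perm (Fin n))
    (h : VR r (fun i j => M (σ i) (σ j))) : VR r M := by
  obtain ⟨a, ha⟩ := h
  refine ⟨fun k x => a k (σ.symm x), fun i j hij => ?_⟩
  obtain ⟨k, hk⟩ := ha (σ.symm i) (σ.symm j) (by simpa using hij)
  exact ⟨k, by simpa using Cov_perm σ hk⟩

/-- `ij|kl` is a (weakly) minimal matching of the quadruple. -/
def CW {n : ℕ} (X : Fin n → Fin n → ℝ) (i j k l : Fin n) : Prop :=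
  X i j + X k l ≤ X i k + X j l ∧ X i j + X k l ≤ X i l + X j k

set_option maxHeartbeats 4000000 in
lemma deg5 {M : Fin 5 → Fin 5 → ℝ} (hM : ∀ i j, M i j = M j i)
    (h1 : CW M 0 1 2 3) (h2 : CW M 0 1 2 4) (h3 : CW M 0 1 3 4) (h4 : CW M 0 2 3 4)
    (h5 : CW M 1 2 3 4 ∨ CW M 1 3 2 4) : VR 2 M := by
  obtain ⟨a, ha, ha'⟩ := star hM 1
  obtain ⟨b, hb, hb'⟩ := star hM 4
  have s10 := hM 1 0
  have s20 := hM 2 0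
  have s21 := hM 2 1
  have s30 := hM 3 0
  have s31 := hM 3 1
  have s32 := hM 3 2
  have s40 := hM 4 0
  have s41 := hM 4 1
  have s42 := hM 4 2
  have s43 := hM 4 3
  simp only [CW] at h1 h2 h3 h4 h5
  obtain ⟨h1, h1'⟩ := h1
  obtain ⟨h2, h2'⟩ := h2
  obtain ⟨h3, h3'⟩ := h3
  obtain ⟨h4, h4'⟩ := h4
  have c02 : Cov M a 0 2 := by
    refine Cov.symm hM (ha' 2 0 (by decide) (by decide) {2} (by decide) (by decide) ?_)
    intro u hu v hv hu1 hv1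
    simp only [Finset.mem_singleton] at hu hv
    subst hu
    fin_cases v <;> simp at hv hv1 ⊢ <;> linarith
  have c03 : Cov M a 0 3 := by
    refine Cov.symm hM (ha' 3 0 (by decide) (by decide) {3} (by decide) (by decide) ?_)
    intro u hu v hv hu1 hv1
    simp only [Finset.mem_singleton] at hu hv
    subst hu
    fin_cases v <;> simp at hv hv1 ⊢ <;> linarith
  have c23 : Cov M b 2 3 := by
    rcases h5 with ⟨h5, h5'⟩ | ⟨h5, h5'⟩
    · refine hb' 2 3 (by decide) (by decide) {2} (by decide) (by decide) ?_
      intro u hu v hv hu1 hv1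
      simp only [Finset.mem_singleton] at hu hv
      subst hu
      fin_cases v <;> simp at hv hv1 ⊢ <;> linarith
    · refine hb' 2 3 (by decide) (by decide) {2, 1} (by decide) (by decide) ?_
      intro u hu v hv hu1 hv1
      fin_cases u <;> simp at hu hu1 <;> fin_cases v <;> simp at hv hv1 ⊢ <;> linarith
  refine VR_of_lt hM ![a, b] ?_
  intro i j hij
  have A : ∀ {i j}, Cov M a i j → ∃ k, Cov M ((![a, b] : Fin 2 → Fin 5 → ℝ) k) i j :=
    fun h => ⟨0, h⟩
  have B : ∀ {i j}, Cov M b i j → ∃ k, Cov M ((![a, b] : Fin 2 → Fin 5 → ℝ) k) i j :=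
    fun h => ⟨1, h⟩
  by_cases hi : i = 1
  · subst hi; exact A (ha j hij.ne')
  by_cases hj : j = 1
  · subst hj; exact A ((ha i hij.ne).symm hM)
  by_cases hj : j = 4
  · subst hj; exact B ((hb i hij.ne).symm hM)
  fin_cases i <;> fin_cases j <;> simp at * <;> first | exact A c02 | exact A c03 | exact B c23

/-- The prism configuration: triangles `0 1 2` and `3 4 5`, rungs `03`, `14`, `25`. -/
def Prism (X : Fin 6 → Fin 6 → ℝ) : Prop :=
  (CW X 0 3 1 4 ∧ CW X 1 4 2 5 ∧ CW X 2 5 0 3) ∧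
  (CW X 0 3 1 2 ∧ CW X 1 4 2 0 ∧ CW X 2 5 0 1) ∧
  (CW X 0 3 4 5 ∧ CW X 1 4 5 3 ∧ CW X 2 5 3 4) ∧
  (CW X 1 2 3 4 ∧ CW X 2 0 4 5 ∧ CW X 0 1 5 3) ∧
  (CW X 1 2 3 5 ∧ CW X 2 0 4 3 ∧ CW X 0 1 5 4)

set_option maxHeartbeats 8000000 in
lemma prism_one {M : Fin 6 → Fin 6 → ℝ} (hM : ∀ i j, M i j = M j i) (h : Prism M) :
    ∃ a, Cov M a 1 2 ∧ Cov M a 4 5 ∧ Cov M a 1 4 ∧ Cov M a 0 4 ∧ Cov M a 0 5 ∧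
      Cov M a 3 1 ∧ Cov M a 3 2 := by
  simp only [Prism, CW] at h
  have s10 := hM 1 0
  have s20 := hM 2 0
  have s21 := hM 2 1
  have s30 := hM 3 0
  have s31 := hM 3 1
  have s32 := hM 3 2
  have s40 := hM 4 0
  have s41 := hM 4 1
  have s42 := hM 4 2
  have s43 := hM 4 3
  have s50 := hM 5 0
  have s51 := hM 5 1
  have s52 := hM 5 2
  have s53 := hM 5 3
  have s54 := hM 5 4
  simp only [s10, s20, s21, s30, s31, s32, s40, s41, s42, s43, s50, s51, s52, s53, s54] at h
  obtain ⟨⟨⟨a1, a2⟩, ⟨a3, a4⟩, ⟨a5, a6⟩⟩, ⟨⟨b1, b2⟩, ⟨b3, b4⟩, ⟨b5, b6⟩⟩,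
    ⟨⟨c1, c2⟩, ⟨c3, c4⟩, ⟨c5, c6⟩⟩, ⟨⟨d1, d2⟩, ⟨d3, d4⟩, ⟨d5, d6⟩⟩,
    ⟨⟨e1, e2⟩, ⟨e3, e4⟩, ⟨e5, e6⟩⟩⟩ := h
  obtain ⟨v4, h4⟩ : ∃ v4, 2 * v4 = M 4 5 + M 0 4 - M 0 5 :=
    ⟨(M 4 5 + M 0 4 - M 0 5) / 2, by ring⟩
  obtain ⟨v5, h5⟩ : ∃ v5, v5 = M 4 5 - v4 := ⟨_, rfl⟩
  obtain ⟨v0, h0⟩ : ∃ v0, v0 = M 0 4 - v4 := ⟨_, rfl⟩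
  obtain ⟨v1, h1⟩ : ∃ v1, v1 = M 1 4 - v4 := ⟨_, rfl⟩
  obtain ⟨v2, h2⟩ : ∃ v2, v2 = M 1 2 - v1 := ⟨_, rfl⟩
  rcases le_total (M 1 3 - v1) (M 2 3 - v2) with hc | hc
  · obtain ⟨v3, h3⟩ : ∃ v3, v3 = M 1 3 - v1 := ⟨_, rfl⟩
    refine ⟨![v0, v1, v2, v3, v4, v5], ?_, ?_, ?_, ?_, ?_, ?_, ?_⟩
    · apply Cov.symm hM
      refine ⟨{2, 4, 3}, by decide, by decide, fun u hu v hv => ?_⟩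
      fin_cases u <;> simp at hu <;> fin_cases v <;> simp at hv ⊢ <;> linarith
    · refine ⟨{2, 4, 3}, by decide, by decide, fun u hu v hv => ?_⟩
      fin_cases u <;> simp at hu <;> fin_cases v <;> simp at hv ⊢ <;> linarith
    · apply Cov.symm hM
      refine ⟨{2, 4, 3}, by decide, by decide, fun u hu v hv => ?_⟩
      fin_cases u <;> simp at hu <;> fin_cases v <;> simp at hv ⊢ <;> linarith
    · refine ⟨{0}, by decide, by decide, fun u hu v hv => ?_⟩
      fin_cases u <;> simp at hu <;> fin_cases v <;> simp at hv ⊢ <;> linarith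
    · refine ⟨{0}, by decide, by decide, fun u hu v hv => ?_⟩
      fin_cases u <;> simp at hu <;> fin_cases v <;> simp at hv ⊢ <;> linarith
    · refine ⟨{2, 4, 3}, by decide, by decide, fun u hu v hv => ?_⟩
      fin_cases u <;> simp at hu <;> fin_cases v <;> simp at hv ⊢ <;> linarith
    · apply Cov.symm hM
      refine ⟨{2, 4}, by decide, by decide, fun u hu v hv => ?_⟩
      fin_cases u <;> simp at hu <;> fin_cases v <;> simp at hv ⊢ <;> linarith
  · obtain ⟨v3, h3⟩ : ∃ v3, v3 = M 2 3 - v2 := ⟨_, rfl⟩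
    refine ⟨![v0, v1, v2, v3, v4, v5], ?_, ?_, ?_, ?_, ?_, ?_, ?_⟩
    · apply Cov.symm hM
      refine ⟨{2, 4}, by decide, by decide, fun u hu v hv => ?_⟩
      fin_cases u <;> simp at hu <;> fin_cases v <;> simp at hv ⊢ <;> linarith
    · refine ⟨{2, 4}, by decide, by decide, fun u hu v hv => ?_⟩
      fin_cases u <;> simp at hu <;> fin_cases v <;> simp at hv ⊢ <;> linarith
    · apply Cov.symm hM
      refine ⟨{2, 4}, by decide, by decide, fun u hu v hv => ?_⟩
      fin_cases u <;> simp at hu <;> fin_cases v <;> simp at hv ⊢ <;> linarith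
    · refine ⟨{0}, by decide, by decide, fun u hu v hv => ?_⟩
      fin_cases u <;> simp at hu <;> fin_cases v <;> simp at hv ⊢ <;> linarith
    · refine ⟨{0}, by decide, by decide, fun u hu v hv => ?_⟩
      fin_cases u <;> simp at hu <;> fin_cases v <;> simp at hv ⊢ <;> linarith
    · apply Cov.symm hM
      refine ⟨{1, 5}, by decide, by decide, fun u hu v hv => ?_⟩
      fin_cases u <;> simp at hu <;> fin_cases v <;> simp at hv ⊢ <;> linarith
    · apply Cov.symm hM
      refine ⟨{2, 4}, by decide, by decide, fun u hu v hv => ?_⟩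
      fin_cases u <;> simp at hu <;> fin_cases v <;> simp at hv ⊢ <;> linarith

/-- A permutation of `Fin 6` from its list of values. -/
noncomputable def mkP (f : Fin 6 → Fin 6) (hf : Function.Injective f) : Equiv.Perm (Fin 6) :=
  Equiv.ofBijective f (Finite.injective_iff_bijective.mp hf)

lemma prism_rot {M : Fin 6 → Fin 6 → ℝ} (h : Prism M) :
    Prism (fun i j => M ((![1, 2, 0, 4, 5, 3] : Fin 6 → Fin 6) i)
      ((![1, 2, 0, 4, 5, 3] : Fin 6 → Fin 6) j)) := by
  obtain ⟨⟨a1, a2, a3⟩, ⟨b1, b2, b3⟩, ⟨c1, c2, c3⟩, ⟨d1, d2, d3⟩, ⟨e1, e2, e3⟩⟩ := h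
  exact ⟨⟨a2, a3, a1⟩, ⟨b2, b3, b1⟩, ⟨c2, c3, c1⟩, ⟨d2, d3, d1⟩, ⟨e2, e3, e1⟩⟩

lemma prism_rot2 {M : Fin 6 → Fin 6 → ℝ} (h : Prism M) :
    Prism (fun i j => M ((![2, 0, 1, 5, 3, 4] : Fin 6 → Fin 6) i)
      ((![2, 0, 1, 5, 3, 4] : Fin 6 → Fin 6) j)) := by
  obtain ⟨⟨a1, a2, a3⟩, ⟨b1, b2, b3⟩, ⟨c1, c2, c3⟩, ⟨d1, d2, d3⟩, ⟨e1, e2, e3⟩⟩ := h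
  exact ⟨⟨a3, a1, a2⟩, ⟨b3, b1, b2⟩, ⟨c3, c1, c2⟩, ⟨d3, d1, d2⟩, ⟨e3, e1, e2⟩⟩

lemma prism_VR {M : Fin 6 → Fin 6 → ℝ} (hM : ∀ i j, M i j = M j i) (h : Prism M) :
    VR 3 M := by
  have key : ∃ a, Cov M a 2 0 ∧ Cov M a 5 3 ∧ Cov M a 2 5 ∧ Cov M a 1 5 ∧ Cov M a 1 3 ∧
      Cov M a 4 2 ∧ Cov M a 4 0 := by
    obtain ⟨a, h1, h2, h3, h4, h5, h6, h7⟩ := prism_one (fun i j => hM _ _) (prism_rot h)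
    let σ := mkP ![1, 2, 0, 4, 5, 3] (by decide)
    exact ⟨fun x => a (σ.symm x), Cov_perm σ h1, Cov_perm σ h2, Cov_perm σ h3, Cov_perm σ h4,
      Cov_perm σ h5, Cov_perm σ h6, Cov_perm σ h7⟩
  have key2 : ∃ a, Cov M a 0 1 ∧ Cov M a 3 4 ∧ Cov M a 0 3 ∧ Cov M a 2 3 ∧ Cov M a 2 4 ∧
      Cov M a 5 0 ∧ Cov M a 5 1 := by
    obtain ⟨a, h1, h2, h3, h4, h5, h6, h7⟩ := prism_one (fun i j => hM _ _) (prism_rot2 h)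
    let σ := mkP ![2, 0, 1, 5, 3, 4] (by decide)
    exact ⟨fun x => a (σ.symm x), Cov_perm σ h1, Cov_perm σ h2, Cov_perm σ h3, Cov_perm σ h4,
      Cov_perm σ h5, Cov_perm σ h6, Cov_perm σ h7⟩
  obtain ⟨a, a1, a2, a3, a4, a5, a6, a7⟩ := prism_one hM h
  obtain ⟨b, b1, b2, b3, b4, b5, b6, b7⟩ := key
  obtain ⟨c, c1, c2, c3, c4, c5, c6, c7⟩ := key2
  refine VR_of_lt hM ![a, b, c] ?_
  intro i j hij
  fin_cases i <;> fin_cases j <;> simp at hij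
  · exact ⟨2, c1⟩
  · exact ⟨1, b1.symm hM⟩
  · exact ⟨2, c3⟩
  · exact ⟨0, a4⟩
  · exact ⟨0, a5⟩
  · exact ⟨0, a1⟩
  · exact ⟨0, a6.symm hM⟩
  · exact ⟨0, a3⟩
  · exact ⟨1, b4⟩
  · exact ⟨0, a7.symm hM⟩
  · exact ⟨2, c5⟩
  · exact ⟨1, b3⟩
  · exact ⟨2, c2⟩
  · exact ⟨1, b2.symm hM⟩
  · exact ⟨0, a2⟩

/-- `ij|kl` is the strictly minimal matching of the quadruple. -/
def C {n : ℕ} (X : Fin n → Fin n → ℝ) (i j k l : Fin n) : Prop :=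
  X i j + X k l < X i k + X j l ∧ X i j + X k l < X i l + X j k

/-- Symmetric, generic, and without a pair which is minimal in all three quadruples
of some 5-subset. -/
def Good (X : Fin 6 → Fin 6 → ℝ) : Prop :=
  (∀ i j, X i j = X j i) ∧
  (∀ i j k l, i ≠ j → i ≠ k → i ≠ l → j ≠ k → j ≠ l → k ≠ l →
    C X i j k l ∨ C X i k j l ∨ C X i l j k) ∧
  (∀ f : Fin 6 → Fin 6, Function.Injective f → C X (f 0) (f 1) (f 2) (f 3) →
    C X (f 0) (f 1) (f 2) (f 4) → C X (f 0) (f 1) (f 3) (f 4) → False)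

section combinatorics

variable {X : Fin 6 → Fin 6 → ℝ}

lemma Good.comp (h : Good X) (f : Fin 6 → Fin 6) (hf : Function.Injective f) :
    Good (fun i j => X (f i) (f j)) := by
  obtain ⟨h1, h2, h3⟩ := h
  refine ⟨fun i j => h1 _ _, fun i j k l a b c d e g => ?_, fun g hg => ?_⟩
  · exact h2 (f i) (f j) (f k) (f l) (hf.ne a) (hf.ne b) (hf.ne c) (hf.ne d) (hf.ne e) (hf.ne g)
  · exact h3 (f ∘ g) (hf.comp hg)

lemma Good.s1 (h : Good X) {i j k l : Fin 6} (hc : C X i j k l) : C X j i k l := by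
  obtain ⟨h1, -, -⟩ := h
  unfold C at *
  rw [h1 j i]
  constructor <;> linarith [hc.1, hc.2]

lemma Good.s2 (h : Good X) {i j k l : Fin 6} (hc : C X i j k l) : C X k l i j := by
  obtain ⟨h1, -, -⟩ := h
  unfold C at *
  rw [h1 k i, h1 l j, h1 k j, h1 l i]
  constructor <;> linarith [hc.1, hc.2]

lemma Good.s3 (h : Good X) {i j k l : Fin 6} (hc : C X i j k l) : C X i j l k :=
  h.s2 (h.s1 (h.s2 hc))

lemma Good.cyc (h : Good X) {i j a b c : Fin 6} (h1 : C X i a j b) (h2 : C X i b j c)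
    (h3 : C X i c j a) : False := by
  obtain ⟨hs, -, -⟩ := h
  unfold C at *
  rw [hs a j] at h1
  rw [hs b j] at h2
  rw [hs c j] at h3
  linarith [h1.2, h2.2, h3.2]

lemma Good.ex (h : Good X) {i j k l : Fin 6} (h1 : C X i j k l) (h2 : C X i k j l) : False := by
  unfold C at *
  linarith [h1.1, h2.1]

set_option maxHeartbeats 4000000 in
/-- Given `01|23`, the vertices `0 1 2 3 4` form one of four pentagons. -/
lemma Good.pent (h : Good X) (h0 : C X 0 1 2 3) :
    (C X 1 2 3 4 ∧ C X 0 4 2 3 ∧ C X 0 1 3 4 ∧ C X 0 4 1 2) ∨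
    (C X 0 2 3 4 ∧ C X 1 4 2 3 ∧ C X 0 1 3 4 ∧ C X 0 2 1 4) ∨
    (C X 1 3 2 4 ∧ C X 0 4 2 3 ∧ C X 0 1 2 4 ∧ C X 0 4 1 3) ∨
    (C X 0 3 2 4 ∧ C X 1 4 2 3 ∧ C X 0 1 2 4 ∧ C X 0 3 1 4) := by
  have e0124 : C X 0 1 2 4 ∨ C X 0 2 1 4 ∨ C X 0 4 1 2 :=
    h.2.1 0 1 2 4 (by decide) (by decide) (by decide) (by decide) (by decide) (by decide)
  have e0134 : C X 0 1 3 4 ∨ C X 0 3 1 4 ∨ C X 0 4 1 3 :=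
    h.2.1 0 1 3 4 (by decide) (by decide) (by decide) (by decide) (by decide) (by decide)
  have e0234 : C X 0 2 3 4 ∨ C X 0 3 2 4 ∨ C X 0 4 2 3 :=
    h.2.1 0 2 3 4 (by decide) (by decide) (by decide) (by decide) (by decide) (by decide)
  have e1234 : C X 1 2 3 4 ∨ C X 1 3 2 4 ∨ C X 1 4 2 3 :=
    h.2.1 1 2 3 4 (by decide) (by decide) (by decide) (by decide) (by decide) (by decide)
  have k1 : C X 0 1 2 3 → C X 0 3 2 4 → C X 0 4 1 2 → False := fun h1 h2 h3 =>
    h.cyc h1 h2 (h.s3 h3)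
  have k2 : C X 0 1 2 3 → C X 0 2 3 4 → C X 0 4 1 3 → False := fun h1 h2 h3 =>
    h.cyc (h.s3 h1) h2 (h.s3 h3)
  have k3 : C X 0 1 2 4 → C X 0 2 3 4 → C X 0 3 1 4 → False := fun h1 h2 h3 =>
    h.cyc (h.s3 h1) (h.s3 h2) (h.s3 h3)
  have k4 : C X 0 1 3 4 → C X 0 3 2 4 → C X 0 2 1 4 → False := fun h1 h2 h3 =>
    h.cyc (h.s3 h1) (h.s3 h2) (h.s3 h3)
  have k5 : C X 0 1 2 3 → C X 1 3 2 4 → C X 0 2 1 4 → False := fun h1 h2 h3 =>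
    h.cyc (h.s1 h1) h2 (h.s2 (h.s1 h3))
  have k6 : C X 0 1 2 3 → C X 1 2 3 4 → C X 0 3 1 4 → False := fun h1 h2 h3 =>
    h.cyc (h.s3 (h.s1 h1)) h2 (h.s2 (h.s1 h3))
  have k7 : C X 0 1 2 4 → C X 1 2 3 4 → C X 0 4 1 3 → False := fun h1 h2 h3 =>
    h.cyc (h.s3 (h.s1 h1)) (h.s3 h2) (h.s2 (h.s1 h3))
  have k8 : C X 0 1 3 4 → C X 1 3 2 4 → C X 0 4 1 2 → False := fun h1 h2 h3 =>
    h.cyc (h.s3 (h.s1 h1)) (h.s3 h2) (h.s2 (h.s1 h3))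
  have k9 : C X 0 2 1 4 → C X 1 2 3 4 → C X 0 4 2 3 → False := fun h1 h2 h3 =>
    h.cyc (h.s3 (h.s1 h1)) (h.s3 (h.s1 h2)) (h.s2 (h.s1 h3))
  have k10 : C X 0 2 3 4 → C X 1 4 2 3 → C X 0 4 1 2 → False := fun h1 h2 h3 =>
    h.cyc (h.s3 (h.s1 h1)) (h.s2 (h.s1 h2)) (h.s1 (h.s2 (h.s1 h3)))
  have k11 : C X 0 3 1 4 → C X 1 3 2 4 → C X 0 4 2 3 → False := fun h1 h2 h3 =>
    h.cyc (h.s3 (h.s1 h1)) (h.s3 (h.s1 h2)) (h.s1 (h.s2 (h.s1 h3)))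
  have k12 : C X 0 3 2 4 → C X 1 4 2 3 → C X 0 4 1 3 → False := fun h1 h2 h3 =>
    h.cyc (h.s3 (h.s1 h1)) (h.s1 (h.s2 (h.s1 h2))) (h.s1 (h.s2 (h.s1 h3)))
  have k13 : C X 0 1 2 3 → C X 0 1 2 4 → C X 0 1 3 4 → False := fun h1 h2 h3 =>
    h.2.2 ![0, 1, 2, 3, 4, 5] (by decide) h1 h2 h3
  have k14 : C X 0 4 1 2 → C X 0 4 1 3 → C X 0 4 2 3 → False := fun h1 h2 h3 =>
    h.2.2 ![0, 4, 1, 2, 3, 5] (by decide) h1 h2 h3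
  have k15 : C X 0 2 1 4 → C X 0 3 1 4 → C X 1 4 2 3 → False := fun h1 h2 h3 =>
    h.2.2 ![1, 4, 0, 2, 3, 5] (by decide) (h.s2 h1) (h.s2 h2) h3
  have k16 : C X 0 1 2 3 → C X 0 4 2 3 → C X 1 4 2 3 → False := fun h1 h2 h3 =>
    h.2.2 ![2, 3, 0, 1, 4, 5] (by decide) (h.s2 h1) (h.s2 h2) (h.s2 h3)
  have k17 : C X 0 1 2 4 → C X 0 3 2 4 → C X 1 3 2 4 → False := fun h1 h2 h3 =>
    h.2.2 ![2, 4, 0, 1, 3, 5] (by decide) (h.s2 h1) (h.s2 h2) (h.s2 h3)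
  have k18 : C X 0 1 3 4 → C X 0 2 3 4 → C X 1 2 3 4 → False := fun h1 h2 h3 =>
    h.2.2 ![3, 4, 0, 1, 2, 5] (by decide) (h.s2 h1) (h.s2 h2) (h.s2 h3)
  have k19 : C X 0 1 2 3 → C X 0 2 1 4 → C X 0 3 2 4 → C X 0 4 1 3 → C X 1 2 3 4 → False := by
    intro h1 h2 h3 h4 h5
    unfold C at h1 h2 h3 h4 h5
    linarith [h1.1, h1.2, h2.1, h2.2, h3.1, h3.2, h4.1, h4.2, h5.1, h5.2,
      h.1 1 0, h.1 2 0, h.1 3 0, h.1 4 0, h.1 2 1, h.1 3 1, h.1 4 1, h.1 3 2, h.1 4 2, h.1 4 3]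
  have k20 : C X 0 1 2 3 → C X 0 2 3 4 → C X 0 3 1 4 → C X 0 4 1 2 → C X 1 3 2 4 → False := by
    intro h1 h2 h3 h4 h5
    unfold C at h1 h2 h3 h4 h5
    linarith [h1.1, h1.2, h2.1, h2.2, h3.1, h3.2, h4.1, h4.2, h5.1, h5.2,
      h.1 1 0, h.1 2 0, h.1 3 0, h.1 4 0, h.1 2 1, h.1 3 1, h.1 4 1, h.1 3 2, h.1 4 2, h.1 4 3]
  clear h
  grind (splits := 40)

/-- The standard pentagon on `0 1 2 3 4`. -/
def P5 (X : Fin 6 → Fin 6 → ℝ) : Prop :=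
  C X 0 1 2 3 ∧ C X 1 2 3 4 ∧ C X 0 4 2 3 ∧ C X 0 1 3 4 ∧ C X 0 4 1 2

lemma Good.exists_P5_aux (h : Good X) (h0 : C X 0 1 2 3) :
    ∃ f : Fin 6 → Fin 6, Function.Injective f ∧ P5 (fun i j => X (f i) (f j)) := by
  rcases h.pent h0 with ⟨h1, h2, h3, h4⟩ | ⟨h1, h2, h3, h4⟩ | ⟨h1, h2, h3, h4⟩ | ⟨h1, h2, h3, h4⟩
  · exact ⟨![0, 1, 2, 3, 4, 5], by decide,
      h0, h1, h2, h3, h4⟩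
  · exact ⟨![1, 0, 2, 3, 4, 5], by decide,
      (h.s1 h0), h1, h2, (h.s1 h3), (h.s2 h4)⟩
  · exact ⟨![0, 1, 3, 2, 4, 5], by decide,
      (h.s3 h0), h1, (h.s3 h2), h3, h4⟩
  · exact ⟨![1, 0, 3, 2, 4, 5], by decide,
      (h.s3 (h.s1 h0)), h1, (h.s3 h2), (h.s1 h3), (h.s2 h4)⟩

lemma Good.exists_P5 (h : Good X) :
    ∃ f : Fin 6 → Fin 6, Function.Injective f ∧ P5 (fun i j => X (f i) (f j)) := by
  rcases h.2.1 0 1 2 3 (by decide) (by decide) (by decide) (by decide) (by decide) (by decide)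
    with h0 | h0 | h0
  · exact h.exists_P5_aux h0
  · have hg : Function.Injective (![0, 2, 1, 3, 4, 5] : Fin 6 → Fin 6) := by decide
    obtain ⟨f, hf, hp⟩ := (h.comp ![0, 2, 1, 3, 4, 5] hg).exists_P5_aux h0
    exact ⟨![0, 2, 1, 3, 4, 5] ∘ f, hg.comp hf, hp⟩
  · have hg : Function.Injective (![0, 3, 1, 2, 4, 5] : Fin 6 → Fin 6) := by decide
    obtain ⟨f, hf, hp⟩ := (h.comp ![0, 3, 1, 2, 4, 5] hg).exists_P5_aux h0
    exact ⟨![0, 3, 1, 2, 4, 5] ∘ f, hg.comp hf, hp⟩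

set_option maxHeartbeats 4000000 in
lemma comb_aux (E : Fin 5 → Fin 5 → Fin 5 → Prop)
    (x012 : ¬ (E 0 1 2 ∧ E 1 0 2) ∧ ¬ (E 0 1 2 ∧ E 2 0 1) ∧ ¬ (E 1 0 2 ∧ E 2 0 1))
    (x013 : ¬ (E 0 1 3 ∧ E 1 0 3) ∧ ¬ (E 0 1 3 ∧ E 3 0 1) ∧ ¬ (E 1 0 3 ∧ E 3 0 1))
    (x014 : ¬ (E 0 1 4 ∧ E 1 0 4) ∧ ¬ (E 0 1 4 ∧ E 4 0 1) ∧ ¬ (E 1 0 4 ∧ E 4 0 1))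
    (x023 : ¬ (E 0 2 3 ∧ E 2 0 3) ∧ ¬ (E 0 2 3 ∧ E 3 0 2) ∧ ¬ (E 2 0 3 ∧ E 3 0 2))
    (x024 : ¬ (E 0 2 4 ∧ E 2 0 4) ∧ ¬ (E 0 2 4 ∧ E 4 0 2) ∧ ¬ (E 2 0 4 ∧ E 4 0 2))
    (x034 : ¬ (E 0 3 4 ∧ E 3 0 4) ∧ ¬ (E 0 3 4 ∧ E 4 0 3) ∧ ¬ (E 3 0 4 ∧ E 4 0 3))
    (x123 : ¬ (E 1 2 3 ∧ E 2 1 3) ∧ ¬ (E 1 2 3 ∧ E 3 1 2) ∧ ¬ (E 2 1 3 ∧ E 3 1 2))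
    (x124 : ¬ (E 1 2 4 ∧ E 2 1 4) ∧ ¬ (E 1 2 4 ∧ E 4 1 2) ∧ ¬ (E 2 1 4 ∧ E 4 1 2))
    (x134 : ¬ (E 1 3 4 ∧ E 3 1 4) ∧ ¬ (E 1 3 4 ∧ E 4 1 3) ∧ ¬ (E 3 1 4 ∧ E 4 1 3))
    (x234 : ¬ (E 2 3 4 ∧ E 3 2 4) ∧ ¬ (E 2 3 4 ∧ E 4 2 3) ∧ ¬ (E 3 2 4 ∧ E 4 2 3))
    (h0 : (E 4 2 3 ∧ E 1 3 4 ∧ E 4 1 2 ∧ E 1 2 3) ∨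
      (E 4 1 3 ∧ E 2 3 4 ∧ E 4 1 2 ∧ E 2 1 3) ∨
      (E 3 2 4 ∧ E 1 3 4 ∧ E 3 1 2 ∧ E 1 2 4) ∨
      (E 3 1 4 ∧ E 2 3 4 ∧ E 3 1 2 ∧ E 2 1 4))
    (h1 : (E 0 3 4 ∧ E 2 0 4 ∧ E 0 2 3 ∧ E 2 3 4) ∨
      (E 0 2 4 ∧ E 3 0 4 ∧ E 0 2 3 ∧ E 3 2 4) ∨
      (E 4 0 3 ∧ E 2 0 4 ∧ E 4 2 3 ∧ E 2 0 3) ∨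
      (E 4 0 2 ∧ E 3 0 4 ∧ E 4 2 3 ∧ E 3 0 2))
    (h2 : (E 1 0 4 ∧ E 3 0 1 ∧ E 1 3 4 ∧ E 3 0 4) ∨
      (E 1 0 3 ∧ E 4 0 1 ∧ E 1 3 4 ∧ E 4 0 3) ∨
      (E 0 1 4 ∧ E 3 0 1 ∧ E 0 3 4 ∧ E 3 1 4) ∨
      (E 0 1 3 ∧ E 4 0 1 ∧ E 0 3 4 ∧ E 4 1 3))
    (h3 : (E 2 0 1 ∧ E 4 1 2 ∧ E 2 0 4 ∧ E 4 0 1) ∨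
      (E 2 1 4 ∧ E 0 1 2 ∧ E 2 0 4 ∧ E 0 1 4) ∨
      (E 1 0 2 ∧ E 4 1 2 ∧ E 1 0 4 ∧ E 4 0 2) ∨
      (E 1 2 4 ∧ E 0 1 2 ∧ E 1 0 4 ∧ E 0 2 4))
    (h4 : (E 3 1 2 ∧ E 0 2 3 ∧ E 3 0 1 ∧ E 0 1 2) ∨
      (E 3 0 2 ∧ E 1 2 3 ∧ E 3 0 1 ∧ E 1 0 2) ∨
      (E 2 1 3 ∧ E 0 2 3 ∧ E 2 0 1 ∧ E 0 1 3) ∨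
      (E 2 0 3 ∧ E 1 2 3 ∧ E 2 0 1 ∧ E 1 0 3))
    : (E 0 1 2 ∧ E 0 1 4 ∧ E 0 2 3 ∧ E 0 3 4 ∧ E 2 0 4 ∧ E 2 1 4 ∧ E 2 3 4 ∧ E 3 0 1 ∧ E 3 1 2 ∧ E 3 1 4) ∨
    (E 0 1 2 ∧ E 0 2 3 ∧ E 0 2 4 ∧ E 1 0 4 ∧ E 1 2 4 ∧ E 1 3 4 ∧ E 3 0 1 ∧ E 3 0 4 ∧ E 3 1 2 ∧ E 3 2 4) ∨
    (E 0 1 3 ∧ E 0 2 3 ∧ E 0 3 4 ∧ E 2 0 1 ∧ E 2 0 4 ∧ E 2 1 3 ∧ E 2 3 4 ∧ E 4 0 1 ∧ E 4 1 2 ∧ E 4 1 3) ∨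
    (E 1 0 2 ∧ E 1 0 4 ∧ E 1 2 3 ∧ E 1 3 4 ∧ E 3 0 1 ∧ E 3 0 2 ∧ E 3 0 4 ∧ E 4 0 2 ∧ E 4 1 2 ∧ E 4 2 3) ∨
    (E 1 0 3 ∧ E 1 2 3 ∧ E 1 3 4 ∧ E 2 0 1 ∧ E 2 0 3 ∧ E 2 0 4 ∧ E 4 0 1 ∧ E 4 0 3 ∧ E 4 1 2 ∧ E 4 2 3) := by
  grind (splits := 40)

/-- Strict version of `Prism`. -/
def PrismS (X : Fin 6 → Fin 6 → ℝ) : Prop :=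
  (C X 0 3 1 4 ∧ C X 1 4 2 5 ∧ C X 2 5 0 3) ∧
  (C X 0 3 1 2 ∧ C X 1 4 2 0 ∧ C X 2 5 0 1) ∧
  (C X 0 3 4 5 ∧ C X 1 4 5 3 ∧ C X 2 5 3 4) ∧
  (C X 1 2 3 4 ∧ C X 2 0 4 5 ∧ C X 0 1 5 3) ∧
  (C X 1 2 3 5 ∧ C X 2 0 4 3 ∧ C X 0 1 5 4)

set_option maxHeartbeats 4000000 in
lemma Good.prism (h : Good X) (hp : P5 X) :
    ∃ f : Fin 6 → Fin 6, Function.Injective f ∧ PrismS (fun i j => X (f i) (f j)) := by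
  obtain ⟨d0, d1, d2, d3, d4⟩ := hp
  have := comb_aux (fun x y z => C X 5 x.castSucc y.castSucc z.castSucc)
    ⟨fun g => h.ex g.1 g.2, fun g => h.ex (h.s3 g.1) g.2, fun g => h.ex (h.s3 g.1) (h.s3 g.2)⟩
    ⟨fun g => h.ex g.1 g.2, fun g => h.ex (h.s3 g.1) g.2, fun g => h.ex (h.s3 g.1) (h.s3 g.2)⟩
    ⟨fun g => h.ex g.1 g.2, fun g => h.ex (h.s3 g.1) g.2, fun g => h.ex (h.s3 g.1) (h.s3 g.2)⟩
    ⟨fun g => h.ex g.1 g.2, fun g => h.ex (h.s3 g.1) g.2, fun g => h.ex (h.s3 g.1) (h.s3 g.2)⟩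
    ⟨fun g => h.ex g.1 g.2, fun g => h.ex (h.s3 g.1) g.2, fun g => h.ex (h.s3 g.1) (h.s3 g.2)⟩
    ⟨fun g => h.ex g.1 g.2, fun g => h.ex (h.s3 g.1) g.2, fun g => h.ex (h.s3 g.1) (h.s3 g.2)⟩
    ⟨fun g => h.ex g.1 g.2, fun g => h.ex (h.s3 g.1) g.2, fun g => h.ex (h.s3 g.1) (h.s3 g.2)⟩
    ⟨fun g => h.ex g.1 g.2, fun g => h.ex (h.s3 g.1) g.2, fun g => h.ex (h.s3 g.1) (h.s3 g.2)⟩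
    ⟨fun g => h.ex g.1 g.2, fun g => h.ex (h.s3 g.1) g.2, fun g => h.ex (h.s3 g.1) (h.s3 g.2)⟩
    ⟨fun g => h.ex g.1 g.2, fun g => h.ex (h.s3 g.1) g.2, fun g => h.ex (h.s3 g.1) (h.s3 g.2)⟩
    (by
      rcases (h.comp ![1, 2, 3, 4, 5, 0] (by decide)).pent (show C X 1 2 3 4 from d1) with
        ⟨h1, h2, h3, h4⟩ | ⟨h1, h2, h3, h4⟩ | ⟨h1, h2, h3, h4⟩ | ⟨h1, h2, h3, h4⟩
      · exact Or.inl ⟨(h.s1 (h.s2 h1)), (h.s1 h2), (h.s1 (h.s2 h3)), (h.s1 h4)⟩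
      · exact Or.inr (Or.inl ⟨(h.s1 (h.s2 h1)), (h.s1 h2), (h.s1 (h.s2 h3)), (h.s1 (h.s2 h4))⟩)
      · exact Or.inr (Or.inr (Or.inl ⟨(h.s1 (h.s2 h1)), (h.s1 h2), (h.s1 (h.s2 h3)), (h.s1 h4)⟩))
      · exact Or.inr (Or.inr (Or.inr ⟨(h.s1 (h.s2 h1)), (h.s1 h2), (h.s1 (h.s2 h3)), (h.s1 (h.s2 h4))⟩)))
    (by
      rcases (h.comp ![2, 3, 4, 0, 5, 1] (by decide)).pent (show C X 2 3 4 0 from (h.s2 (h.s1 d2))) with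
        ⟨h1, h2, h3, h4⟩ | ⟨h1, h2, h3, h4⟩ | ⟨h1, h2, h3, h4⟩ | ⟨h1, h2, h3, h4⟩
      · exact Or.inl ⟨(h.s1 (h.s2 h1)), (h.s3 (h.s1 h2)), (h.s1 (h.s2 h3)), (h.s1 h4)⟩
      · exact Or.inr (Or.inl ⟨(h.s1 (h.s2 h1)), (h.s3 (h.s1 h2)), (h.s1 (h.s2 h3)), (h.s1 (h.s2 h4))⟩)
      · exact Or.inr (Or.inr (Or.inl ⟨(h.s1 (h.s2 (h.s1 h1))), (h.s3 (h.s1 h2)), (h.s1 (h.s2 h3)), (h.s3 (h.s1 h4))⟩))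
      · exact Or.inr (Or.inr (Or.inr ⟨(h.s1 (h.s2 (h.s1 h1))), (h.s3 (h.s1 h2)), (h.s1 (h.s2 h3)), (h.s1 (h.s2 (h.s1 h4)))⟩)))
    (by
      rcases (h.comp ![3, 4, 0, 1, 5, 2] (by decide)).pent (show C X 3 4 0 1 from (h.s2 d3)) with
        ⟨h1, h2, h3, h4⟩ | ⟨h1, h2, h3, h4⟩ | ⟨h1, h2, h3, h4⟩ | ⟨h1, h2, h3, h4⟩
      · exact Or.inl ⟨(h.s1 (h.s2 (h.s1 h1))), (h.s1 h2), (h.s1 (h.s2 h3)), (h.s3 (h.s1 h4))⟩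
      · exact Or.inr (Or.inl ⟨(h.s1 (h.s2 (h.s1 h1))), (h.s1 h2), (h.s1 (h.s2 h3)), (h.s1 (h.s2 (h.s1 h4)))⟩)
      · exact Or.inr (Or.inr (Or.inl ⟨(h.s1 (h.s2 (h.s1 h1))), (h.s1 h2), (h.s1 (h.s2 h3)), (h.s3 (h.s1 h4))⟩))
      · exact Or.inr (Or.inr (Or.inr ⟨(h.s1 (h.s2 (h.s1 h1))), (h.s1 h2), (h.s1 (h.s2 h3)), (h.s1 (h.s2 (h.s1 h4)))⟩)))
    (by
      rcases (h.comp ![4, 0, 1, 2, 5, 3] (by decide)).pent (show C X 4 0 1 2 from (h.s1 d4)) with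
        ⟨h1, h2, h3, h4⟩ | ⟨h1, h2, h3, h4⟩ | ⟨h1, h2, h3, h4⟩ | ⟨h1, h2, h3, h4⟩
      · exact Or.inl ⟨(h.s1 (h.s2 h1)), (h.s1 h2), (h.s1 (h.s2 (h.s1 h3))), (h.s1 h4)⟩
      · exact Or.inr (Or.inl ⟨(h.s1 (h.s2 (h.s1 h1))), (h.s1 h2), (h.s1 (h.s2 (h.s1 h3))), (h.s1 (h.s2 (h.s1 h4)))⟩)
      · exact Or.inr (Or.inr (Or.inl ⟨(h.s1 (h.s2 h1)), (h.s1 h2), (h.s1 (h.s2 (h.s1 h3))), (h.s1 h4)⟩))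
      · exact Or.inr (Or.inr (Or.inr ⟨(h.s1 (h.s2 (h.s1 h1))), (h.s1 h2), (h.s1 (h.s2 (h.s1 h3))), (h.s1 (h.s2 (h.s1 h4)))⟩)))
    (by
      rcases (h.comp ![0, 1, 2, 3, 5, 4] (by decide)).pent (show C X 0 1 2 3 from d0) with
        ⟨h1, h2, h3, h4⟩ | ⟨h1, h2, h3, h4⟩ | ⟨h1, h2, h3, h4⟩ | ⟨h1, h2, h3, h4⟩
      · exact Or.inl ⟨(h.s1 (h.s2 h1)), (h.s1 h2), (h.s1 (h.s2 h3)), (h.s1 h4)⟩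
      · exact Or.inr (Or.inl ⟨(h.s1 (h.s2 h1)), (h.s1 h2), (h.s1 (h.s2 h3)), (h.s1 (h.s2 h4))⟩)
      · exact Or.inr (Or.inr (Or.inl ⟨(h.s1 (h.s2 h1)), (h.s1 h2), (h.s1 (h.s2 h3)), (h.s1 h4)⟩))
      · exact Or.inr (Or.inr (Or.inr ⟨(h.s1 (h.s2 h1)), (h.s1 h2), (h.s1 (h.s2 h3)), (h.s1 (h.s2 h4))⟩)))
  rcases this with ⟨e0, e1, e2, e3, e4, e5, e6, e7, e8, e9⟩ |
    ⟨e0, e1, e2, e3, e4, e5, e6, e7, e8, e9⟩ |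
    ⟨e0, e1, e2, e3, e4, e5, e6, e7, e8, e9⟩ |
    ⟨e0, e1, e2, e3, e4, e5, e6, e7, e8, e9⟩ |
    ⟨e0, e1, e2, e3, e4, e5, e6, e7, e8, e9⟩
  · refine ⟨![0, 1, 4, 5, 2, 3], by decide, ?_⟩
    exact ⟨⟨(h.s1 e0), (h.s3 d1), (h.s1 (h.s2 (h.s1 e3)))⟩,
      ⟨(h.s1 e1), (h.s2 (h.s1 d4)), (h.s1 (h.s2 d3))⟩,
      ⟨(h.s1 e2), (h.s2 (h.s1 e8)), (h.s1 (h.s2 e6))⟩,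
      ⟨(h.s2 e5), (h.s1 d2), (h.s2 (h.s1 e7))⟩,
      ⟨(h.s2 e9), (h.s1 (h.s2 (h.s1 e4))), (h.s3 d0)⟩⟩
  · refine ⟨![0, 1, 5, 4, 2, 3], by decide, ?_⟩
    exact ⟨⟨d4, (h.s2 e8), e7⟩,
      ⟨(h.s2 (h.s1 e3)), (h.s2 e0), e6⟩,
      ⟨d2, d1, (h.s3 e9)⟩,
      ⟨(h.s3 (h.s1 e4)), e1, d3⟩,
      ⟨(h.s3 (h.s1 e5)), e2, (h.s3 d0)⟩⟩
  · refine ⟨![0, 4, 5, 1, 3, 2], by decide, ?_⟩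
    exact ⟨⟨(h.s3 d3), (h.s1 (h.s2 e6)), e3⟩,
      ⟨(h.s2 (h.s1 e7)), (h.s1 (h.s2 e2)), e4⟩,
      ⟨(h.s3 d0), (h.s1 (h.s2 (h.s1 d1))), e5⟩,
      ⟨(h.s1 e9), (h.s3 e1), (h.s3 d4)⟩,
      ⟨(h.s1 e8), (h.s3 e0), d2⟩⟩
  · refine ⟨![0, 1, 2, 4, 5, 3], by decide, ?_⟩
    exact ⟨⟨(h.s2 (h.s1 e1)), (h.s1 e2), (h.s2 d2)⟩,
      ⟨d4, (h.s3 (h.s1 e0)), (h.s2 d0)⟩,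
      ⟨(h.s2 e6), (h.s1 e3), (h.s2 (h.s1 e9))⟩,
      ⟨(h.s2 (h.s1 e8)), (h.s1 (h.s2 e5)), d3⟩,
      ⟨(h.s3 d1), (h.s1 (h.s2 e7)), (h.s2 (h.s1 e4))⟩⟩
  · refine ⟨![0, 3, 4, 1, 2, 5], by decide, ?_⟩
    exact ⟨⟨(h.s3 d0), (h.s1 (h.s2 (h.s1 e9))), (h.s1 e6)⟩,
      ⟨d3, (h.s1 (h.s2 (h.s1 d2))), (h.s1 e7)⟩,
      ⟨(h.s2 (h.s1 e3)), (h.s1 (h.s2 e1)), (h.s1 e8)⟩,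
      ⟨(h.s2 d1), (h.s1 (h.s2 (h.s1 e5))), (h.s2 e0)⟩,
      ⟨(h.s2 (h.s1 e2)), (h.s3 (h.s1 d4)), (h.s2 e4)⟩⟩

end combinatorics

lemma perturb {n : ℕ} {M : Fin n → Fin n → ℝ} (hM : ∀ i j, M i j = M j i) :
    ∃ X : Fin n → Fin n → ℝ, (∀ i j, X i j = X j i) ∧
      (∀ i j k l, X i j + X k l < X i k + X j l → M i j + M k l ≤ M i k + M j l) ∧
      (∀ i j k l, i ≠ l → j ≠ k → X i j + X k l ≠ X i k + X j l) := by
  let w : Fin n → Fin n → ℝ := fun i j => ((i : ℕ) : ℝ) * ((j : ℕ) : ℝ)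
  obtain ⟨L, hL⟩ := exists_ub (fun p : Fin n × Fin n × Fin n × Fin n =>
    (w p.1 p.2.1 + w p.2.2.1 p.2.2.2 - w p.1 p.2.2.1 - w p.2.1 p.2.2.2) /
    (M p.1 p.2.2.1 + M p.2.1 p.2.2.2 - M p.1 p.2.1 - M p.2.2.1 p.2.2.2))
  have hK : 0 < max L 0 + 1 := by positivity
  obtain ⟨ε, hε, hεK⟩ : ∃ ε : ℝ, 0 < ε ∧ ε * (max L 0 + 1) = 1 :=
    ⟨(max L 0 + 1)⁻¹, by positivity, inv_mul_cancel₀ hK.ne'⟩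
  have key : ∀ i j k l, M i j + M k l < M i k + M j l →
      M i j + ε * w i j + (M k l + ε * w k l) < M i k + ε * w i k + (M j l + ε * w j l) := by
    intro i j k l h
    have h1 := hL (i, j, k, l)
    simp only at h1
    have hg : 0 < M i k + M j l - M i j - M k l := by linarith
    have h2 : w i j + w k l - w i k - w j l < (max L 0 + 1) * (M i k + M j l - M i j - M k l) := by
      rw [div_le_iff₀ hg] at h1
      have h3 : L < max L 0 + 1 := by linarith [le_max_left L 0]
      nlinarith
    have h4 := mul_lt_mul_of_pos_left h2 hε
    have h5 : ε * ((max L 0 + 1) * (M i k + M j l - M i j - M k l)) =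
        M i k + M j l - M i j - M k l := by rw [← mul_assoc, hεK, one_mul]
    rw [h5] at h4
    linarith
  refine ⟨fun i j => M i j + ε * w i j, fun i j => ?_, fun i j k l h => ?_,
    fun i j k l hil hjk h => ?_⟩
  · simp only [w]; rw [hM i j]; ring
  · by_contra hc
    have := key i k j l (by linarith)
    linarith
  · simp only at h
    rcases lt_trichotomy (M i j + M k l) (M i k + M j l) with h1 | h1 | h1
    · exact absurd h (key i j k l h1).ne
    · have h2 : ε * (w i j + w k l - w i k - w j l) = 0 := by linarith
      have h3 : w i j + w k l - w i k - w j l =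
          (((i : ℕ) : ℝ) - ((l : ℕ) : ℝ)) * (((j : ℕ) : ℝ) - ((k : ℕ) : ℝ)) := by
        simp only [w]; ring
      rw [h3] at h2
      have e1 : ((i : ℕ) : ℝ) - ((l : ℕ) : ℝ) ≠ 0 := by
        rw [sub_ne_zero]; exact_mod_cast fun e => hil (Fin.ext e)
      have e2 : ((j : ℕ) : ℝ) - ((k : ℕ) : ℝ) ≠ 0 := by
        rw [sub_ne_zero]; exact_mod_cast fun e => hjk (Fin.ext e)
      exact (mul_ne_zero hε.ne' (mul_ne_zero e1 e2)) h2
    · exact absurd h.symm (key i k j l h1).ne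

lemma deg6 {M : Fin 6 → Fin 6 → ℝ} (hM : ∀ i j, M i j = M j i)
    (h1 : CW M 0 1 2 3) (h2 : CW M 0 1 2 4) (h3 : CW M 0 1 3 4) (h4 : CW M 0 2 3 4)
    (h5 : CW M 1 2 3 4 ∨ CW M 1 3 2 4) : VR 3 M :=
  VR_succ hM (deg5 (fun _ _ => hM _ _) h1 h2 h3 h4 h5)

/-- Any choice of minimal matchings. -/
lemma CW_total {n : ℕ} {M : Fin n → Fin n → ℝ} (hM : ∀ i j, M i j = M j i) (i j k l : Fin n) :
    CW M i j k l ∨ CW M i k j l ∨ CW M i l j k := by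
  unfold CW
  rw [hM k j, hM l k, hM l j]
  grind

lemma CW.s3 {n : ℕ} {M : Fin n → Fin n → ℝ} (hM : ∀ i j, M i j = M j i) {i j k l : Fin n}
    (h : CW M i j k l) : CW M i j l k := by
  unfold CW at *
  rw [hM l k]
  exact ⟨h.2, h.1⟩

lemma VR_comp {r : ℕ} {M : Fin 6 → Fin 6 → ℝ} (f : Fin 6 → Fin 6) (hf : Function.Injective f)
    (h : VR r (fun i j => M (f i) (f j))) : VR r M := VR_perm (mkP f hf) h

lemma deg6a {M : Fin 6 → Fin 6 → ℝ} (hM : ∀ i j, M i j = M j i)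
    (h1 : CW M 0 1 2 3) (h2 : CW M 0 1 2 4) (h3 : CW M 0 1 3 4) (h4 : CW M 0 2 3 4) :
    VR 3 M := by
  rcases CW_total hM 1 2 3 4 with h | h | h
  · exact deg6 hM h1 h2 h3 h4 (Or.inl h)
  · exact deg6 hM h1 h2 h3 h4 (Or.inr h)
  · exact VR_comp ![0, 1, 2, 4, 3, 5] (by decide)
      (deg6 (fun _ _ => hM _ _) h2 h1 (h3.s3 hM) (h4.s3 hM) (Or.inr h))

lemma deg6b {M : Fin 6 → Fin 6 → ℝ} (hM : ∀ i j, M i j = M j i)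
    (h1 : CW M 0 1 2 3) (h2 : CW M 0 1 2 4) (h3 : CW M 0 1 3 4) : VR 3 M := by
  rcases CW_total hM 0 2 3 4 with h | h | h
  · exact deg6a hM h1 h2 h3 h
  · exact VR_comp ![0, 1, 3, 2, 4, 5] (by decide)
      (deg6a (fun _ _ => hM _ _) (h1.s3 hM) h3 h2 h)
  · exact VR_comp ![0, 1, 4, 2, 3, 5] (by decide)
      (deg6a (fun _ _ => hM _ _) (h2.s3 hM) (h3.s3 hM) h1 h)

lemma six {M : Fin 6 → Fin 6 → ℝ} (hM : ∀ i j, M i j = M j i) : VR 3 M := by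
  obtain ⟨X, hX, hc, hne⟩ := perturb hM
  have hC : ∀ {i j k l}, C X i j k l → CW M i j k l := by
    intro i j k l h
    refine ⟨hc _ _ _ _ h.1, ?_⟩
    have := hc i j l k (by rw [hX l k]; exact h.2)
    rw [hM l k] at this
    exact this
  by_contra hV
  have hG : Good X := by
    refine ⟨hX, ?_, ?_⟩
    · intro i j k l hij hik hil hjk hjl hkl
      have e1 := hne i j k l hil hjk
      have e2 := hne i j l k hik hjl
      have e3 := hne i k l j hij hkl
      rw [hX l k] at e2
      rw [hX l j, hX k j] at e3
      unfold C
      rw [hX k j, hX l k, hX l j]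
      grind
    · intro f hf h1 h2 h3
      exact hV (VR_comp f hf (deg6b (fun _ _ => hM _ _) (hC h1) (hC h2) (hC h3)))
  obtain ⟨f, hf, hp⟩ := hG.exists_P5
  obtain ⟨g, hg, hq⟩ := (hG.comp f hf).prism hp
  apply hV
  refine VR_comp (f ∘ g) (hf.comp hg) (prism_VR (fun _ _ => hM _ _) ?_)
  obtain ⟨⟨a1, a2, a3⟩, ⟨b1, b2, b3⟩, ⟨c1, c2, c3⟩, ⟨d1, d2, d3⟩, ⟨e1, e2, e3⟩⟩ := hq
  exact ⟨⟨hC a1, hC a2, hC a3⟩, ⟨hC b1, hC b2, hC b3⟩, ⟨hC c1, hC c2, hC c3⟩,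
    ⟨hC d1, hC d2, hC d3⟩, ⟨hC e1, hC e2, hC e3⟩⟩

lemma general (m : ℕ) : ∀ M : Fin (6 + m) → Fin (6 + m) → ℝ, (∀ i j, M i j = M j i) →
    VR (3 + m) M := by
  induction m with
  | zero => exact fun M hM => six hM
  | succ m ih => exact fun M hM => VR_succ (n := 6 + m) (r := 3 + m) hM (ih _ fun _ _ => hM _ _)

theorem stmt15 :
    (∀ M : Fin 6 → Fin 6 → ℝ, (∀ i j, M i j = M j i) → TreeRankLe 3 M) ∧
    (∀ n : ℕ, 6 ≤ n → ∀ M : Fin n → Fin n → ℝ, (∀ i j, M i j = M j i) →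
      TreeRankLe (n - 3) M) := by
  refine ⟨fun M hM => treeRank_of_VR hM (six hM), fun n hn M hM => ?_⟩
  obtain ⟨m, rfl⟩ := Nat.exists_eq_add_of_le hn
  have e : 6 + m - 3 = 3 + m := by omega
  rw [e]
  exact treeRank_of_VR hM (general m M hM)
end
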